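/- arXiv:1512.04303 — 3 statements merged into one kernel-verified Lean document; each statement's English description precedes it below -/
import Mathlib

section
/- Let S be a finite set of pairwise distinct trajectories and let 𝒞* be an SD-optimal k-clustering of S. Then for any two distinct nonempty clusters C₁ and C₂ of 𝒞*, there is a hole of S separating C₁ and C₂. -/
noncomputable section

/-- Position at time `t` of the trajectory `(a, v)`, i.e. `a + v*t`. -/
def trajPos (s : ℝ × ℝ) (t : ℝ) : ℝ := s.1 + s.2 * t

/-- Diameter of a finite set of trajectories: the integral over `[0,1]` of the
width of the set of positions; `0` for the empty set. -/
noncomputable def kdiam (C : Finset (ℝ × ℝ)) : ℝ :=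
  if h : C.Nonempty then
    ∫ t in (0:ℝ)..1,
      (C.sup' h (fun s => trajPos s t) - C.inf' h (fun s => trajPos s t))
  else 0

/-- A `k`-clustering of `S`: pairwise disjoint (possibly empty) clusters
indexed by `Fin k` whose union is `S`. -/
def IsClustering (S : Finset (ℝ × ℝ)) (k : ℕ) (𝒞 : Fin k → Finset (ℝ × ℝ)) : Prop :=
  (∀ i j : Fin k, i ≠ j → Disjoint (𝒞 i) (𝒞 j)) ∧
  Finset.univ.biUnion 𝒞 = S

/-- Sum of the diameters of the clusters. -/
noncomputable def sd {k : ℕ} (𝒞 : Fin k → Finset (ℝ × ℝ)) : ℝ :=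
  ∑ i, kdiam (𝒞 i)

/-- Maximum diameter of a cluster. -/
noncomputable def md {k : ℕ} (𝒞 : Fin k → Finset (ℝ × ℝ)) : ℝ :=
  ⨆ i, kdiam (𝒞 i)

/-- An SD-optimal `k`-clustering: minimizes `sd` among all `k`-clusterings of `S`. -/
def SDOptimal (S : Finset (ℝ × ℝ)) (k : ℕ) (𝒞 : Fin k → Finset (ℝ × ℝ)) : Prop :=
  IsClustering S k 𝒞 ∧
  ∀ 𝒟 : Fin k → Finset (ℝ × ℝ), IsClustering S k 𝒟 → sd 𝒞 ≤ sd 𝒟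

/-- Optimal value of the maximum diameter over all `k`-clusterings of `S`. -/
noncomputable def optmd (S : Finset (ℝ × ℝ)) (k : ℕ) : ℝ :=
  sInf {x | ∃ 𝒞 : Fin k → Finset (ℝ × ℝ), IsClustering S k 𝒞 ∧ x = md 𝒞}

/-- The strip `{(x,t) : 0 ≤ t ≤ 1}`. -/
def strip : Set (ℝ × ℝ) := {p | 0 ≤ p.2 ∧ p.2 ≤ 1}

/-- The graph of a trajectory inside the strip. -/
def trajGraph (s : ℝ × ℝ) : Set (ℝ × ℝ) :=
  {p | 0 ≤ p.2 ∧ p.2 ≤ 1 ∧ p.1 = trajPos s p.2}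

/-- The strip minus the union of the graphs of the trajectories of `S`. -/
def freeRegion (S : Finset (ℝ × ℝ)) : Set (ℝ × ℝ) :=
  strip \ ⋃ s ∈ S, trajGraph s

/-- A hole of `S`: a connected component of the strip minus the graphs. -/
def IsHole (S : Finset (ℝ × ℝ)) (h : Set (ℝ × ℝ)) : Prop :=
  ∃ p ∈ freeRegion S, h = connectedComponentIn (freeRegion S) p

/-- `s` is to the left of the hole `h`. -/
def LeftOf (s : ℝ × ℝ) (h : Set (ℝ × ℝ)) : Prop :=
  ∃ p ∈ h, trajPos s p.2 < p.1

open Classical in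
/-- The trajectories of `S` to the left of `h`. -/
noncomputable def Sleft (S : Finset (ℝ × ℝ)) (h : Set (ℝ × ℝ)) : Finset (ℝ × ℝ) :=
  S.filter (fun s => LeftOf s h)

open Classical in
/-- The trajectories of `S` to the right of `h`. -/
noncomputable def Sright (S : Finset (ℝ × ℝ)) (h : Set (ℝ × ℝ)) : Finset (ℝ × ℝ) :=
  S.filter (fun s => ¬ LeftOf s h)

/-- The hole `h` separates the clusters `A` and `B`. -/
def Separates (S : Finset (ℝ × ℝ)) (h : Set (ℝ × ℝ))
    (A B : Finset (ℝ × ℝ)) : Prop :=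
  (A ⊆ Sleft S h ∧ B ⊆ Sright S h) ∨ (B ⊆ Sleft S h ∧ A ⊆ Sright S h)

/-- The span of a cluster: the region of the strip between its left and right sides. -/
noncomputable def cspan (C : Finset (ℝ × ℝ)) : Set (ℝ × ℝ) :=
  if h : C.Nonempty then
    {p | 0 ≤ p.2 ∧ p.2 ≤ 1 ∧
      C.inf' h (fun s => trajPos s p.2) ≤ p.1 ∧
      p.1 ≤ C.sup' h (fun s => trajPos s p.2)}
  else ∅

/-- A hole is covered by a clustering if it is contained in the span of some cluster. -/
def Covered {k : ℕ} (𝒞 : Fin k → Finset (ℝ × ℝ)) (h : Set (ℝ × ℝ)) : Prop :=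
  ∃ i, h ⊆ cspan (𝒞 i)

/-- A well-separated clustering: every two distinct nonempty clusters are
separated by some uncovered hole. -/
def WellSeparated (S : Finset (ℝ × ℝ)) (k : ℕ)
    (𝒞 : Fin k → Finset (ℝ × ℝ)) : Prop :=
  IsClustering S k 𝒞 ∧
  ∀ i j : Fin k, i ≠ j → (𝒞 i).Nonempty → (𝒞 j).Nonempty →
    ∃ h, IsHole S h ∧ ¬ Covered 𝒞 h ∧ Separates S h (𝒞 i) (𝒞 j)

end

lemma continuous_trajPos (s : ℝ × ℝ) : Continuous (trajPos s) := by
  unfold trajPos; fun_prop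

/-- The width at time `t` of a nonempty set of trajectories is continuous in `t`. -/
lemma continuous_width (C : Finset (ℝ × ℝ)) (h : C.Nonempty) :
    Continuous fun t : ℝ =>
      C.sup' h (fun s => trajPos s t) - C.inf' h (fun s => trajPos s t) :=
  (Continuous.finset_sup'_apply h fun s _ => continuous_trajPos s).sub
    (Continuous.finset_inf'_apply h fun s _ => continuous_trajPos s)

lemma kdiam_singleton (s : ℝ × ℝ) : kdiam {s} = 0 := by
  simp [kdiam]

/-- If the position intervals of `A` and `B` meet at all times, then merging `A` and `B`
does not increase the sum of the diameters. -/
lemma kdiam_union_le {A B : Finset (ℝ × ℝ)} (hA : A.Nonempty) (hB : B.Nonempty)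
    (hAB : ∀ t ∈ Set.Icc (0 : ℝ) 1,
      B.inf' hB (fun s => trajPos s t) ≤ A.sup' hA (fun s => trajPos s t))
    (hBA : ∀ t ∈ Set.Icc (0 : ℝ) 1,
      A.inf' hA (fun s => trajPos s t) ≤ B.sup' hB (fun s => trajPos s t)) :
    kdiam (A ∪ B) ≤ kdiam A + kdiam B := by
  have hU : (A ∪ B).Nonempty := hA.mono Finset.subset_union_left
  rw [kdiam, kdiam, kdiam, dif_pos hA, dif_pos hB, dif_pos hU,
    ← intervalIntegral.integral_add ((continuous_width A hA).intervalIntegrable _ _)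
      ((continuous_width B hB).intervalIntegrable _ _)]
  refine intervalIntegral.integral_mono_on zero_le_one
    ((continuous_width _ hU).intervalIntegrable _ _)
    (((continuous_width A hA).add (continuous_width B hB)).intervalIntegrable _ _) ?_
  intro t ht
  have h₁ := hAB t ht
  have h₂ := hBA t ht
  obtain ⟨a, ha⟩ := hA
  obtain ⟨b, hb⟩ := hB
  have h₃ := (A.inf'_le (fun s => trajPos s t) ha).trans (A.le_sup' (fun s => trajPos s t) ha)
  have h₄ := (B.inf'_le (fun s => trajPos s t) hb).trans (B.le_sup' (fun s => trajPos s t) hb)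
  rw [Finset.sup'_union ⟨a, ha⟩ ⟨b, hb⟩, Finset.inf'_union ⟨a, ha⟩ ⟨b, hb⟩]
  rcases max_choice (A.sup' ⟨a, ha⟩ fun s => trajPos s t)
      (B.sup' ⟨b, hb⟩ fun s => trajPos s t) with h | h <;>
    rcases min_choice (A.inf' ⟨a, ha⟩ fun s => trajPos s t)
      (B.inf' ⟨b, hb⟩ fun s => trajPos s t) with h' | h' <;>
    rw [h, h'] <;> linarith

/-- At some time in `[0,1]`, distinct trajectories of a finite set have distinct positions. -/
lemma exists_injOn_trajPos (U : Finset (ℝ × ℝ)) :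
    ∃ t ∈ Set.Icc (0 : ℝ) 1, Set.InjOn (fun s => trajPos s t) U := by
  obtain ⟨t, ht, hn⟩ := (Set.Icc_infinite (zero_lt_one' ℝ)).exists_notMem_finset
    ((U ×ˢ U).image fun q => -(q.1.1 - q.2.1) / (q.1.2 - q.2.2))
  refine ⟨t, ht, fun p hp q hq hpq => ?_⟩
  simp only [trajPos] at hpq
  by_contra hne
  have hv : p.2 - q.2 ≠ 0 := by
    intro hv
    have hv' : p.2 = q.2 := sub_eq_zero.mp hv
    rw [hv'] at hpq
    exact hne (Prod.ext (add_right_cancel hpq) hv')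
  refine hn (Finset.mem_image.mpr ⟨(p, q), Finset.mk_mem_product hp hq, ?_⟩)
  rw [div_eq_iff hv]
  linarith

/-- In a set of at least two trajectories, removing some trajectory strictly decreases
the diameter. -/
lemma exists_kdiam_erase_lt {U : Finset (ℝ × ℝ)} (hU : U.Nontrivial) :
    ∃ s ∈ U, kdiam (U.erase s) < kdiam U := by
  obtain ⟨t, ht, hinj⟩ := exists_injOn_trajPos U
  obtain ⟨s, hs, hmax⟩ := U.exists_max_image (fun s => trajPos s t) hU.nonempty
  have hE : (U.erase s).Nonempty := hU.erase_nonempty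
  have hinf : ∀ t : ℝ, U.inf' hU.nonempty (fun s => trajPos s t) ≤
      (U.erase s).inf' hE (fun s => trajPos s t) :=
    fun t => Finset.inf'_mono _ (Finset.erase_subset s U) hE
  refine ⟨s, hs, ?_⟩
  rw [kdiam, kdiam, dif_pos hE, dif_pos hU.nonempty]
  refine intervalIntegral.integral_lt_integral_of_continuousOn_of_le_of_exists_lt zero_lt_one
    (continuous_width _ _).continuousOn (continuous_width _ _).continuousOn
    (fun r _ => sub_le_sub (Finset.sup'_mono _ (Finset.erase_subset s U) hE) (hinf r))
    ⟨t, ht, ?_⟩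
  refine (sub_lt_sub_right ?_ _).trans_le (sub_le_sub_left (hinf t) _)
  rw [Finset.sup'_lt_iff]
  intro r hr
  obtain ⟨hrs, hrU⟩ := Finset.mem_erase.mp hr
  exact ((hmax r hrU).lt_of_ne fun h => hrs (hinj hrU hs h)).trans_le
    (U.le_sup' (fun s => trajPos s t) hs)

/-- In an SD-optimal clustering, no redistribution of the union of two clusters into two
clusters has smaller cost. -/
lemma SDOptimal.add_le {S : Finset (ℝ × ℝ)} {k : ℕ} {𝒞 : Fin k → Finset (ℝ × ℝ)}
    (hopt : SDOptimal S k 𝒞) {i j : Fin k} (hij : i ≠ j) {X Y : Finset (ℝ × ℝ)}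
    (hXY : Disjoint X Y) (hU : X ∪ Y = 𝒞 i ∪ 𝒞 j) :
    kdiam (𝒞 i) + kdiam (𝒞 j) ≤ kdiam X + kdiam Y := by
  obtain ⟨⟨hdisj, hunion⟩, hmin⟩ := hopt
  set 𝒟 : Fin k → Finset (ℝ × ℝ) := fun l => if l = i then X else if l = j then Y else 𝒞 l
    with h𝒟
  have hi : 𝒟 i = X := by simp [h𝒟]
  have hj : 𝒟 j = Y := by simp [h𝒟, hij.symm]
  have hl : ∀ l, l ≠ i → l ≠ j → 𝒟 l = 𝒞 l := fun l h h' => by simp [h𝒟, h, h']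
  have hmem : ∀ s, s ∈ X ∨ s ∈ Y ↔ s ∈ 𝒞 i ∨ s ∈ 𝒞 j := fun s => by
    rw [← Finset.mem_union, hU, Finset.mem_union]
  have hother : ∀ l, l ≠ i → l ≠ j → Disjoint (𝒞 l) X ∧ Disjoint (𝒞 l) Y := by
    intro l h h'
    rw [← Finset.disjoint_union_right, hU, Finset.disjoint_union_right]
    exact ⟨hdisj _ _ h, hdisj _ _ h'⟩
  have hclust : IsClustering S k 𝒟 := by
    constructor
    · intro l m hlm
      by_cases h₁ : l = i <;> by_cases h₂ : l = j <;> by_cases h₃ : m = i <;>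
        by_cases h₄ : m = j
      all_goals try (exfalso; subst_vars; first | exact hlm rfl | exact hij rfl)
      · subst h₁ h₄; rw [hi, hj]; exact hXY
      · subst h₁; rw [hi, hl m h₃ h₄]; exact (hother m h₃ h₄).1.symm
      · subst h₂ h₃; rw [hi, hj]; exact hXY.symm
      · subst h₂; rw [hj, hl m h₃ h₄]; exact (hother m h₃ h₄).2.symm
      · subst h₃; rw [hi, hl l h₁ h₂]; exact (hother l h₁ h₂).1
      · subst h₄; rw [hj, hl l h₁ h₂]; exact (hother l h₁ h₂).2
      · rw [hl l h₁ h₂, hl m h₃ h₄]; exact hdisj l m hlm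
    · rw [← hunion]
      have hsplit : ∀ (ℰ : Fin k → Finset (ℝ × ℝ)) (s : ℝ × ℝ), (∃ l, s ∈ ℰ l) ↔
          (s ∈ ℰ i ∨ s ∈ ℰ j) ∨ ∃ l, l ≠ i ∧ l ≠ j ∧ s ∈ ℰ l := by
        intro ℰ s
        constructor
        · rintro ⟨l, hs⟩
          by_cases h : l = i
          · exact Or.inl (Or.inl (h ▸ hs))
          by_cases h' : l = j
          · exact Or.inl (Or.inr (h' ▸ hs))
          exact Or.inr ⟨l, h, h', hs⟩
        · rintro ((hs | hs) | ⟨l, _, _, hs⟩)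
          exacts [⟨_, hs⟩, ⟨_, hs⟩, ⟨_, hs⟩]
      ext s
      simp only [Finset.mem_biUnion, Finset.mem_univ, true_and]
      rw [hsplit 𝒟, hsplit 𝒞, hi, hj, hmem]
      refine or_congr_right (exists_congr fun l => ?_)
      refine and_congr_right fun h => and_congr_right fun h' => ?_
      rw [hl l h h']
  have hle := hmin 𝒟 hclust
  have hji : j ∈ Finset.univ.erase i := Finset.mem_erase.mpr ⟨hij.symm, Finset.mem_univ j⟩
  have hrest : ∑ l ∈ (Finset.univ.erase i).erase j, kdiam (𝒟 l) =
      ∑ l ∈ (Finset.univ.erase i).erase j, kdiam (𝒞 l) := by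
    refine Finset.sum_congr rfl fun l h => ?_
    simp only [Finset.mem_erase, Finset.mem_univ, and_true] at h
    rw [hl l h.2 h.1]
  rw [sd, sd, ← Finset.add_sum_erase _ _ (Finset.mem_univ i), ← Finset.add_sum_erase _ _ hji,
    ← Finset.add_sum_erase _ (fun l => kdiam (𝒟 l)) (Finset.mem_univ i),
    ← Finset.add_sum_erase _ (fun l => kdiam (𝒟 l)) hji, hrest, hi, hj] at hle
  linarith

/-- Whether a trajectory of `S` is to the left of a hole can be tested at any of its points. -/
lemma leftOf_connectedComponentIn_iff {S : Finset (ℝ × ℝ)} {s p : ℝ × ℝ} (hs : s ∈ S)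
    (hp : p ∈ freeRegion S) :
    LeftOf s (connectedComponentIn (freeRegion S) p) ↔ trajPos s p.2 < p.1 := by
  refine ⟨fun ⟨q, hq, hlt⟩ => ?_, fun h => ⟨p, mem_connectedComponentIn hp, h⟩⟩
  by_contra! hle
  have hcont : Continuous fun q : ℝ × ℝ => trajPos s q.2 - q.1 :=
    ((continuous_trajPos s).comp continuous_snd).sub continuous_fst
  obtain ⟨r, hr, h0⟩ := isPreconnected_connectedComponentIn.intermediate_value hq
    (mem_connectedComponentIn hp) hcont.continuousOn
    (show (0 : ℝ) ∈ Set.Icc _ _ from ⟨(sub_neg.mpr hlt).le, sub_nonneg.mpr hle⟩)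
  obtain ⟨hstrip, hfree⟩ := connectedComponentIn_subset _ _ hr
  exact hfree (Set.mem_biUnion hs ⟨hstrip.1, hstrip.2, (sub_eq_zero.mp h0).symm⟩)

lemma mem_Sleft {S : Finset (ℝ × ℝ)} {h : Set (ℝ × ℝ)} {s : ℝ × ℝ} :
    s ∈ Sleft S h ↔ s ∈ S ∧ LeftOf s h := by
  simp [Sleft]

lemma mem_Sright {S : Finset (ℝ × ℝ)} {h : Set (ℝ × ℝ)} {s : ℝ × ℝ} :
    s ∈ Sright S h ↔ s ∈ S ∧ ¬ LeftOf s h := by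
  simp [Sright]

/-- If at some time all of `A` lies strictly to the left of all of `B`, then some hole has
`A` on its left and `B` on its right. -/
lemma exists_isHole_subset_Sleft_Sright {S A B : Finset (ℝ × ℝ)} (hAS : A ⊆ S) (hBS : B ⊆ S)
    (hA : A.Nonempty) (hB : B.Nonempty) {t : ℝ} (ht : t ∈ Set.Icc (0 : ℝ) 1)
    (hlt : A.sup' hA (fun s => trajPos s t) < B.inf' hB (fun s => trajPos s t)) :
    ∃ h, IsHole S h ∧ A ⊆ Sleft S h ∧ B ⊆ Sright S h := by
  obtain ⟨x, hx, hn⟩ := (Set.Ioo_infinite hlt).exists_notMem_finset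
    (S.image fun s => trajPos s t)
  have hp : (x, t) ∈ freeRegion S := by
    refine ⟨ht, fun hmem => ?_⟩
    obtain ⟨s, hs, -, -, hxs⟩ := Set.mem_iUnion₂.mp hmem
    exact hn (Finset.mem_image.mpr ⟨s, hs, hxs.symm⟩)
  refine ⟨_, ⟨_, hp, rfl⟩, fun a ha => ?_, fun b hb => ?_⟩
  · exact mem_Sleft.mpr ⟨hAS ha, (leftOf_connectedComponentIn_iff (hAS ha) hp).mpr
      ((A.le_sup' (fun s => trajPos s t) ha).trans_lt hx.1)⟩
  · exact mem_Sright.mpr ⟨hBS hb, fun hleft =>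
      ((leftOf_connectedComponentIn_iff (hBS hb) hp).mp hleft).not_ge
        (hx.2.le.trans (B.inf'_le (fun s => trajPos s t) hb))⟩

/-- any two distinct nonempty clusters of an SD-optimal clustering
are separated by a hole of `S`. -/
theorem stmt1 (S : Finset (ℝ × ℝ)) (k : ℕ) (𝒞 : Fin k → Finset (ℝ × ℝ))
    (hopt : SDOptimal S k 𝒞) (i j : Fin k) (hij : i ≠ j)
    (hi : (𝒞 i).Nonempty) (hj : (𝒞 j).Nonempty) :
    ∃ h, IsHole S h ∧ Separates S h (𝒞 i) (𝒞 j) := by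
  have hsub : ∀ l, 𝒞 l ⊆ S := fun l => by
    rw [← hopt.1.2]
    exact Finset.subset_biUnion_of_mem 𝒞 (Finset.mem_univ l)
  by_cases hAB : ∃ t ∈ Set.Icc (0 : ℝ) 1,
      (𝒞 i).sup' hi (fun s => trajPos s t) < (𝒞 j).inf' hj (fun s => trajPos s t)
  · obtain ⟨t, ht, hlt⟩ := hAB
    obtain ⟨h, hh, hsep⟩ :=
      exists_isHole_subset_Sleft_Sright (hsub i) (hsub j) hi hj ht hlt
    exact ⟨h, hh, Or.inl hsep⟩
  by_cases hBA : ∃ t ∈ Set.Icc (0 : ℝ) 1,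
      (𝒞 j).sup' hj (fun s => trajPos s t) < (𝒞 i).inf' hi (fun s => trajPos s t)
  · obtain ⟨t, ht, hlt⟩ := hBA
    obtain ⟨h, hh, hsep⟩ :=
      exists_isHole_subset_Sleft_Sright (hsub j) (hsub i) hj hi ht hlt
    exact ⟨h, hh, Or.inr hsep⟩
  exfalso
  push Not at hAB hBA
  have hnt : (𝒞 i ∪ 𝒞 j).Nontrivial := by
    obtain ⟨a, ha⟩ := hi
    obtain ⟨b, hb⟩ := hj
    exact ⟨a, Finset.mem_union_left _ ha, b, Finset.mem_union_right _ hb,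
      fun hab => Finset.disjoint_left.mp (hopt.1.1 i j hij) ha (hab ▸ hb)⟩
  obtain ⟨s, hs, hlt⟩ := exists_kdiam_erase_lt hnt
  have hle := hopt.add_le hij
    (X := {s}) (Y := (𝒞 i ∪ 𝒞 j).erase s) (by simp)
    (by rw [← Finset.insert_eq, Finset.insert_erase hs])
  rw [kdiam_singleton, zero_add] at hle
  exact (hle.trans_lt hlt).not_ge (kdiam_union_le hi hj hAB hBA)
end

section
/- Let S be a finite set of n pairwise distinct trajectories. Then the set of holes of S is finite, and its cardinality is at most n(n+1)/2 + 1. -/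
open Classical in
/-- The trajectories of `S` strictly to the left of the point `p`. -/
noncomputable def leftPattern (S : Finset (ℝ × ℝ)) (p : ℝ × ℝ) : Finset S :=
  Finset.univ.filter (fun s => trajPos s p.2 < p.1)

lemma mem_leftPattern {S : Finset (ℝ × ℝ)} {p : ℝ × ℝ} {s : S} :
    s ∈ leftPattern S p ↔ trajPos s p.2 < p.1 := by
  simp [leftPattern]

lemma mem_freeRegion {S : Finset (ℝ × ℝ)} {p : ℝ × ℝ} :
    p ∈ freeRegion S ↔ (0 ≤ p.2 ∧ p.2 ≤ 1) ∧ ∀ s ∈ S, p.1 ≠ trajPos s p.2 := by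
  simp only [freeRegion, strip, trajGraph, Set.mem_sdiff, Set.mem_ofPred_eq, Set.mem_iUnion,
    not_exists, not_and]
  exact ⟨fun h => ⟨h.1, fun s hs => h.2 s hs h.1.1 h.1.2⟩, fun h => ⟨h.1, fun s hs _ _ => h.2 s hs⟩⟩

lemma convex_leftOf_trajPos (s : ℝ × ℝ) : Convex ℝ {p : ℝ × ℝ | p.1 < trajPos s p.2} := by
  have : {p : ℝ × ℝ | p.1 < trajPos s p.2}
      = {p | (LinearMap.fst ℝ ℝ ℝ - s.2 • LinearMap.snd ℝ ℝ ℝ) p < s.1} := by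
    ext p
    simp [trajPos, sub_lt_iff_lt_add]
  rw [this]
  exact convex_halfSpace_lt (LinearMap.isLinear _) _

lemma convex_rightOf_trajPos (s : ℝ × ℝ) : Convex ℝ {p : ℝ × ℝ | trajPos s p.2 < p.1} := by
  have : {p : ℝ × ℝ | trajPos s p.2 < p.1}
      = {p | s.1 < (LinearMap.fst ℝ ℝ ℝ - s.2 • LinearMap.snd ℝ ℝ ℝ) p} := by
    ext p
    simp [trajPos, lt_sub_iff_add_lt]
  rw [this]
  exact convex_halfSpace_gt (LinearMap.isLinear _) _

lemma convex_strip : Convex ℝ strip :=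
  (convex_halfSpace_ge (LinearMap.snd ℝ ℝ ℝ).isLinear 0).inter
    (convex_halfSpace_le (LinearMap.snd ℝ ℝ ℝ).isLinear 1)

lemma segment_subset_freeRegion {S : Finset (ℝ × ℝ)} {p q : ℝ × ℝ} (hp : p ∈ freeRegion S)
    (hq : q ∈ freeRegion S) (h : leftPattern S p = leftPattern S q) :
    segment ℝ p q ⊆ freeRegion S := by
  rw [mem_freeRegion] at hp hq
  intro r hr
  refine mem_freeRegion.2 ⟨convex_strip.segment_subset hp.1 hq.1 hr, fun s hs => ?_⟩
  have hiff : trajPos s p.2 < p.1 ↔ trajPos s q.2 < q.1 := by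
    simpa only [mem_leftPattern] using Finset.ext_iff.1 h ⟨s, hs⟩
  rcases lt_or_gt_of_ne (hp.2 s hs) with hlt | hgt
  · have hlt' : q.1 < trajPos s q.2 :=
      lt_of_le_of_ne (not_lt.1 fun hc => hlt.not_gt (hiff.2 hc)) (hq.2 s hs)
    exact ((convex_leftOf_trajPos s).segment_subset hlt hlt' hr).ne
  · exact ((convex_rightOf_trajPos s).segment_subset hgt (hiff.1 hgt) hr).ne'

lemma connectedComponentIn_freeRegion_eq {S : Finset (ℝ × ℝ)} {p q : ℝ × ℝ}
    (hp : p ∈ freeRegion S) (hq : q ∈ freeRegion S) (h : leftPattern S p = leftPattern S q) :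
    connectedComponentIn (freeRegion S) p = connectedComponentIn (freeRegion S) q :=
  connectedComponentIn_eq <|
    (convex_segment p q).isPreconnected.subset_connectedComponentIn (left_mem_segment ℝ p q)
      (segment_subset_freeRegion hp hq h) (right_mem_segment ℝ p q)

/-- Among three trajectories, the one of intermediate speed cannot be separated from the other two
in both ways. -/
lemma trajPos_lt_of_speed_between {x y z : ℝ × ℝ} (hxy : x.2 ≤ y.2) (hyz : y.2 ≤ z.2) :
    (∀ p : ℝ × ℝ, trajPos x p.2 < p.1 → trajPos z p.2 < p.1 → trajPos y p.2 < p.1) ∨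
    (∀ p : ℝ × ℝ, trajPos y p.2 < p.1 → trajPos x p.2 < p.1 ∨ trajPos z p.2 < p.1) := by
  simp only [trajPos]
  rcases (hxy.trans hyz).eq_or_lt with hxz | hxz
  · have hy : y.2 = x.2 := le_antisymm (hyz.trans hxz.ge) hxy
    rw [← hxz, hy]
    rcases le_total x.1 y.1 with h | h
    · exact Or.inr fun p hp => Or.inl (by linarith)
    · exact Or.inl fun p hp _ => by linarith
  · rcases le_total ((z.2 - x.2) * y.1) ((z.2 - y.2) * x.1 + (y.2 - x.2) * z.1) with h | h
    · refine Or.inl fun p hx hz => ?_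
      by_contra! hy
      rcases hxy.eq_or_lt with hxy' | hxy'
      · nlinarith [mul_pos (sub_pos.2 hxz) (sub_pos.2 hx),
          mul_le_mul_of_nonneg_left hy (sub_pos.2 hxz).le]
      · nlinarith [mul_pos (sub_pos.2 hxy') (sub_pos.2 hz),
          mul_nonneg (sub_nonneg.2 hyz) (sub_pos.2 hx).le,
          mul_nonneg (sub_pos.2 hxz).le (sub_nonneg.2 hy)]
    · refine Or.inr fun p hy => ?_
      by_contra! hc
      nlinarith [mul_nonneg (sub_nonneg.2 hxy) (sub_nonneg.2 hc.2),
        mul_nonneg (sub_nonneg.2 hyz) (sub_nonneg.2 hc.1), mul_pos (sub_pos.2 hxz) (sub_pos.2 hy)]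

open Classical in
/-- The family of all left patterns of points in the plane. -/
noncomputable def leftPatterns (S : Finset (ℝ × ℝ)) : Finset (Finset S) :=
  Finset.univ.filter (fun A => ∃ p, leftPattern S p = A)

lemma leftPattern_mem_leftPatterns (S : Finset (ℝ × ℝ)) (p : ℝ × ℝ) :
    leftPattern S p ∈ leftPatterns S := by
  simp [leftPatterns]

open Classical in
lemma exists_trajPos_lt_iff_of_shatters {S : Finset (ℝ × ℝ)} {A B : Finset S}
    (hA : (leftPatterns S).Shatters A) (hB : B ⊆ A) :
    ∃ p : ℝ × ℝ, ∀ s ∈ A, trajPos s p.2 < p.1 ↔ s ∈ B := by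
  obtain ⟨u, hu, rfl⟩ := hA hB
  obtain ⟨p, rfl⟩ := (Finset.mem_filter.1 hu).2
  exact ⟨p, fun s hs => by simp [hs, mem_leftPattern]⟩

open Classical in
lemma not_shatters_of_speed_between {S : Finset (ℝ × ℝ)} {T : Finset S} {x y z : S}
    (hT : (leftPatterns S).Shatters T) (hx : x ∈ T) (hy : y ∈ T) (hz : z ∈ T)
    (hne : x ≠ y) (hne' : y ≠ z) (hxy : x.1.2 ≤ y.1.2) (hyz : y.1.2 ≤ z.1.2) : False := by
  rcases trajPos_lt_of_speed_between hxy hyz with h | h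
  · obtain ⟨p, hp⟩ := exists_trajPos_lt_iff_of_shatters hT (B := {x, z})
      (by simp [Finset.insert_subset_iff, hx, hz])
    have := (hp y hy).1 (h p ((hp x hx).2 (by simp)) ((hp z hz).2 (by simp)))
    simp [hne.symm, hne'] at this
  · obtain ⟨p, hp⟩ := exists_trajPos_lt_iff_of_shatters hT (B := {y}) (by simpa using hy)
    rcases h p ((hp y hy).2 (by simp)) with h | h
    · exact hne (by simpa using (hp x hx).1 h)
    · exact hne' (by simpa [eq_comm] using (hp z hz).1 h)

open Classical in
lemma vcDim_leftPatterns_le_two (S : Finset (ℝ × ℝ)) : (leftPatterns S).vcDim ≤ 2 := by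
  refine Finset.sup_le fun T hT => ?_
  rw [Finset.mem_shatterer] at hT
  by_contra! hc
  obtain ⟨x, hx, y, hy, z, hz, hxy, hxz, hyz⟩ := Finset.two_lt_card.1 hc
  rcases le_total x.1.2 y.1.2 with h₁ | h₁ <;> rcases le_total y.1.2 z.1.2 with h₂ | h₂ <;>
    rcases le_total x.1.2 z.1.2 with h₃ | h₃ <;>
    first
    | exact not_shatters_of_speed_between hT hx hy hz hxy hyz h₁ h₂
    | exact not_shatters_of_speed_between hT hx hz hy hxz hyz.symm h₃ h₂
    | exact not_shatters_of_speed_between hT hy hx hz hxy.symm hxz h₁ h₃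
    | exact not_shatters_of_speed_between hT hz hx hy hxz.symm hxy h₃ h₁
    | exact not_shatters_of_speed_between hT hz hy hx hyz.symm hxy.symm h₂ h₁
    | exact not_shatters_of_speed_between hT hy hz hx hyz hxz.symm h₂ h₃

open Classical in
lemma card_leftPatterns_le (S : Finset (ℝ × ℝ)) :
    (leftPatterns S).card ≤ S.card * (S.card + 1) / 2 + 1 := by
  calc (leftPatterns S).card
      ≤ ∑ k ∈ Finset.Iic (leftPatterns S).vcDim, (Fintype.card S).choose k :=
        (Finset.card_le_card_shatterer _).trans Finset.card_shatterer_le_sum_vcDim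
    _ ≤ ∑ k ∈ Finset.Iic 2, (Fintype.card S).choose k :=
        Finset.sum_le_sum_of_subset (Finset.Iic_subset_Iic.2 (vcDim_leftPatterns_le_two S))
    _ = S.card.choose 2 + S.card + 1 := by
        rw [Fintype.card_coe, show Finset.Iic 2 = {0, 1, 2} from rfl]
        simp
        ring
    _ = S.card * (S.card + 1) / 2 + 1 := by
        have h := Nat.triangle_succ S.card
        rw [Nat.add_sub_cancel] at h
        rw [mul_comm, h, Nat.choose_two_right]

/-- the set of holes of `S` is finite and has at most
`n(n+1)/2 + 1` elements. -/
theorem stmt15 (S : Finset (ℝ × ℝ)) :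
    {h : Set (ℝ × ℝ) | IsHole S h}.Finite ∧
    Nat.card {h : Set (ℝ × ℝ) | IsHole S h} ≤ S.card * (S.card + 1) / 2 + 1 := by
  classical
  choose! p hp hcomp using fun (h : Set (ℝ × ℝ)) (hh : IsHole S h) => hh
  have hmaps : Set.MapsTo (fun h => leftPattern S (p h)) {h | IsHole S h} (leftPatterns S) :=
    fun h _ => leftPattern_mem_leftPatterns S (p h)
  have hinj : Set.InjOn (fun h => leftPattern S (p h)) {h | IsHole S h} := fun h hh k hk e => by
    rw [hcomp h hh, hcomp k hk]
    exact connectedComponentIn_freeRegion_eq (hp h hh) (hp k hk) e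
  refine ⟨Set.Finite.of_injOn hmaps hinj (leftPatterns S).finite_toSet, ?_⟩
  rw [Nat.card_coe_set_eq]
  refine (Set.ncard_le_ncard_of_injOn _ hmaps hinj (leftPatterns S).finite_toSet).trans ?_
  rw [Set.ncard_coe_finset]
  exact card_leftPatterns_le S
end

section
/- Let S be a finite nonempty set of pairwise distinct trajectories. Then exactly two holes of S are unbounded subsets of ℝ². -/
theorem freeRegion_fst_ne {S : Finset (ℝ × ℝ)} {p s : ℝ × ℝ} (hp : p ∈ freeRegion S)
    (hs : s ∈ S) : p.1 ≠ trajPos s p.2 := fun h =>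
  hp.2 (Set.mem_biUnion hs ⟨hp.1.1, hp.1.2, h⟩)

theorem mem_freeRegion_of_forall_ne {S : Finset (ℝ × ℝ)} {p : ℝ × ℝ} (hp : p ∈ strip)
    (h : ∀ s ∈ S, p.1 ≠ trajPos s p.2) : p ∈ freeRegion S := by
  refine ⟨hp, fun hmem => ?_⟩
  obtain ⟨s, hs, -, -, heq⟩ := Set.mem_iUnion₂.1 hmem
  exact h s hs heq

theorem isPreconnected_strip_right {f : ℝ → ℝ} (hf : Continuous f) :
    IsPreconnected (strip ∩ {p | f p.2 < p.1}) := by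
  have h : strip ∩ {p | f p.2 < p.1} =
      (fun q : ℝ × ℝ => (f q.1 + q.2, q.1)) '' (Set.Icc 0 1 ×ˢ Set.Ioi 0) := by
    ext ⟨x, t⟩
    constructor
    · rintro ⟨ht, hx⟩
      exact ⟨(t, x - f t), ⟨ht, Set.mem_Ioi.2 (sub_pos.2 hx)⟩, by simp⟩
    · rintro ⟨⟨t', u⟩, ⟨ht, hu⟩, heq⟩
      obtain ⟨rfl, rfl⟩ := Prod.mk.inj heq
      exact ⟨ht, Set.mem_ofPred.2 (lt_add_of_pos_right _ hu)⟩
  rw [h]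
  exact (isPreconnected_Icc.prod isPreconnected_Ioi).image _ (by fun_prop)

theorem isPreconnected_strip_left {f : ℝ → ℝ} (hf : Continuous f) :
    IsPreconnected (strip ∩ {p | p.1 < f p.2}) := by
  have h : strip ∩ {p | p.1 < f p.2} =
      (fun q : ℝ × ℝ => (f q.1 - q.2, q.1)) '' (Set.Icc 0 1 ×ˢ Set.Ioi 0) := by
    ext ⟨x, t⟩
    constructor
    · rintro ⟨ht, hx⟩
      exact ⟨(t, f t - x), ⟨ht, Set.mem_Ioi.2 (sub_pos.2 hx)⟩, by simp⟩
    · rintro ⟨⟨t', u⟩, ⟨ht, hu⟩, heq⟩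
      obtain ⟨rfl, rfl⟩ := Prod.mk.inj heq
      exact ⟨ht, Set.mem_ofPred.2 (sub_lt_self _ hu)⟩
  rw [h]
  exact (isPreconnected_Icc.prod isPreconnected_Ioi).image _ (by fun_prop)

/-- A preconnected relatively clopen subset is the connected component of each of its points. -/
theorem connectedComponentIn_eq_inter {X : Type*} [TopologicalSpace X] {F U V : Set X}
    (hU : IsOpen U) (hV : IsOpen V) (hUV : Disjoint U V) (hF : F ⊆ U ∪ V)
    (hc : IsPreconnected (F ∩ U)) {p : X} (hp : p ∈ F ∩ U) :
    connectedComponentIn F p = F ∩ U := by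
  refine Set.Subset.antisymm (Set.subset_inter (connectedComponentIn_subset _ _) ?_)
    (hc.subset_connectedComponentIn hp Set.inter_subset_left)
  exact isPreconnected_connectedComponentIn.subset_left_of_subset_union hU hV hUV
    ((connectedComponentIn_subset _ _).trans hF)
    ⟨p, mem_connectedComponentIn hp.1, hp.2⟩

theorem not_isBounded_strip_right (f : ℝ → ℝ) :
    ¬ Bornology.IsBounded (strip ∩ {p | f p.2 < p.1}) := by
  intro hb
  obtain ⟨M, hM⟩ := hb.exists_norm_le
  have hmem : (max (f 0) M + 1, (0 : ℝ)) ∈ strip ∩ {p | f p.2 < p.1} :=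
    ⟨⟨le_rfl, zero_le_one⟩, (le_max_left (f 0) M).trans_lt (lt_add_one _)⟩
  have h := (norm_fst_le _).trans (hM _ hmem)
  have h' := (le_abs_self _).trans h
  linarith [le_max_right (f 0) M]

theorem not_isBounded_strip_left (f : ℝ → ℝ) :
    ¬ Bornology.IsBounded (strip ∩ {p | p.1 < f p.2}) := by
  intro hb
  obtain ⟨M, hM⟩ := hb.exists_norm_le
  have hmem : (min (f 0) (-M) - 1, (0 : ℝ)) ∈ strip ∩ {p | p.1 < f p.2} :=
    ⟨⟨le_rfl, zero_le_one⟩, (sub_one_lt _).trans_le (min_le_left (f 0) (-M))⟩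
  have h := (norm_fst_le _).trans (hM _ hmem)
  have h' := (neg_le_abs _).trans h
  linarith [min_le_right (f 0) (-M)]

theorem isBounded_strip_between {f g : ℝ → ℝ} (hf : Continuous f) (hg : Continuous g) :
    Bornology.IsBounded (strip ∩ {p | f p.2 ≤ p.1 ∧ p.1 ≤ g p.2}) := by
  obtain ⟨a, ha⟩ := (isCompact_Icc (a := (0 : ℝ)) (b := 1)).bddBelow_image hf.continuousOn
  obtain ⟨b, hb⟩ := (isCompact_Icc (a := (0 : ℝ)) (b := 1)).bddAbove_image hg.continuousOn
  refine ((Metric.isBounded_Icc a b).prod (Metric.isBounded_Icc (0 : ℝ) 1)).subset ?_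
  rintro p ⟨hp, hfp, hgp⟩
  exact ⟨⟨(ha ⟨p.2, hp, rfl⟩).trans hfp, hgp.trans (hb ⟨p.2, hp, rfl⟩)⟩, hp⟩

theorem connectedComponentIn_freeRegion_left {S : Finset (ℝ × ℝ)} {f : ℝ → ℝ}
    (hf : Continuous f) (hne : ∀ p ∈ freeRegion S, p.1 ≠ f p.2)
    (hfree : ∀ p ∈ strip, p.1 < f p.2 → p ∈ freeRegion S) {p : ℝ × ℝ} (hp : p ∈ strip)
    (hlt : p.1 < f p.2) :
    connectedComponentIn (freeRegion S) p = strip ∩ {p | p.1 < f p.2} := by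
  have heq : freeRegion S ∩ {p | p.1 < f p.2} = strip ∩ {p | p.1 < f p.2} :=
    Set.Subset.antisymm (Set.inter_subset_inter_left _ Set.sdiff_subset)
      fun q hq => ⟨hfree q hq.1 hq.2, hq.2⟩
  rw [← heq]
  refine connectedComponentIn_eq_inter (V := {p : ℝ × ℝ | f p.2 < p.1})
    (isOpen_lt (by fun_prop) (by fun_prop)) (isOpen_lt (by fun_prop) (by fun_prop)) ?_ ?_ ?_
    ⟨hfree p hp hlt, hlt⟩
  · exact Set.disjoint_left.2 fun q h₁ h₂ => lt_asymm (Set.mem_ofPred.1 h₁) (Set.mem_ofPred.1 h₂)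
  · intro q hq
    simpa using (hne q hq).lt_or_gt
  · rw [heq]
    exact isPreconnected_strip_left hf

theorem connectedComponentIn_freeRegion_right {S : Finset (ℝ × ℝ)} {f : ℝ → ℝ}
    (hf : Continuous f) (hne : ∀ p ∈ freeRegion S, p.1 ≠ f p.2)
    (hfree : ∀ p ∈ strip, f p.2 < p.1 → p ∈ freeRegion S) {p : ℝ × ℝ} (hp : p ∈ strip)
    (hlt : f p.2 < p.1) :
    connectedComponentIn (freeRegion S) p = strip ∩ {p | f p.2 < p.1} := by
  have heq : freeRegion S ∩ {p | f p.2 < p.1} = strip ∩ {p | f p.2 < p.1} :=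
    Set.Subset.antisymm (Set.inter_subset_inter_left _ Set.sdiff_subset)
      fun q hq => ⟨hfree q hq.1 hq.2, hq.2⟩
  rw [← heq]
  refine connectedComponentIn_eq_inter (V := {p : ℝ × ℝ | p.1 < f p.2})
    (isOpen_lt (by fun_prop) (by fun_prop)) (isOpen_lt (by fun_prop) (by fun_prop)) ?_ ?_ ?_
    ⟨hfree p hp hlt, hlt⟩
  · exact Set.disjoint_left.2 fun q h₁ h₂ => lt_asymm (Set.mem_ofPred.1 h₁) (Set.mem_ofPred.1 h₂)
  · intro q hq
    simpa using (hne q hq).lt_or_gt.symm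
  · rw [heq]
    exact isPreconnected_strip_right hf

/-- The leftmost position of the trajectories as a function of time. -/
theorem exists_left_envelope (S : Finset (ℝ × ℝ)) (hS : S.Nonempty) :
    ∃ f : ℝ → ℝ, Continuous f ∧ (∀ s ∈ S, ∀ t, f t ≤ trajPos s t) ∧
      ∀ t, ∃ s ∈ S, f t = trajPos s t :=
  ⟨fun t => S.inf' hS fun s => trajPos s t,
    Continuous.finset_inf'_apply hS fun s _ => by unfold trajPos; fun_prop,
    fun _ hs t => Finset.inf'_le (fun s => trajPos s t) hs,
    fun t => S.exists_mem_eq_inf' hS fun s => trajPos s t⟩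

/-- The rightmost position of the trajectories as a function of time. -/
theorem exists_right_envelope (S : Finset (ℝ × ℝ)) (hS : S.Nonempty) :
    ∃ f : ℝ → ℝ, Continuous f ∧ (∀ s ∈ S, ∀ t, trajPos s t ≤ f t) ∧
      ∀ t, ∃ s ∈ S, f t = trajPos s t :=
  ⟨fun t => S.sup' hS fun s => trajPos s t,
    Continuous.finset_sup'_apply hS fun s _ => by unfold trajPos; fun_prop,
    fun _ hs t => Finset.le_sup' (fun s => trajPos s t) hs,
    fun t => S.exists_mem_eq_sup' hS fun s => trajPos s t⟩

/-- a nonempty finite set of trajectories has exactly two unbounded holes. -/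
theorem stmt16 (S : Finset (ℝ × ℝ)) (hS : S.Nonempty) :
    ∃ h₁ h₂ : Set (ℝ × ℝ), h₁ ≠ h₂ ∧
      IsHole S h₁ ∧ ¬ Bornology.IsBounded h₁ ∧
      IsHole S h₂ ∧ ¬ Bornology.IsBounded h₂ ∧
      ∀ h, IsHole S h → ¬ Bornology.IsBounded h → h = h₁ ∨ h = h₂ := by
  obtain ⟨L, hLc, hLle, hLmem⟩ := exists_left_envelope S hS
  obtain ⟨R, hRc, hleR, hRmem⟩ := exists_right_envelope S hS
  have hLR : L 0 ≤ R 0 := by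
    obtain ⟨s, hs⟩ := hS
    exact (hLle s hs 0).trans (hleR s hs 0)
  have hneL : ∀ p ∈ freeRegion S, p.1 ≠ L p.2 := fun p hp h => by
    obtain ⟨s, hs, heq⟩ := hLmem p.2
    exact freeRegion_fst_ne hp hs (h.trans heq)
  have hneR : ∀ p ∈ freeRegion S, p.1 ≠ R p.2 := fun p hp h => by
    obtain ⟨s, hs, heq⟩ := hRmem p.2
    exact freeRegion_fst_ne hp hs (h.trans heq)
  have hfreeL : ∀ p ∈ strip, p.1 < L p.2 → p ∈ freeRegion S := fun p hp hlt =>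
    mem_freeRegion_of_forall_ne hp fun s hs => (hlt.trans_le (hLle s hs p.2)).ne
  have hfreeR : ∀ p ∈ strip, R p.2 < p.1 → p ∈ freeRegion S := fun p hp hlt =>
    mem_freeRegion_of_forall_ne hp fun s hs => ((hleR s hs p.2).trans_lt hlt).ne'
  have hstrip : ∀ x : ℝ, (x, (0 : ℝ)) ∈ strip := fun _ => ⟨le_rfl, zero_le_one⟩
  have hltL : L 0 - 1 < L 0 := sub_one_lt _
  have hltR : R 0 < R 0 + 1 := lt_add_one _
  refine ⟨strip ∩ {p | p.1 < L p.2}, strip ∩ {p | R p.2 < p.1}, ?_,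
    ⟨_, hfreeL _ (hstrip _) hltL,
      (connectedComponentIn_freeRegion_left hLc hneL hfreeL (hstrip _) hltL).symm⟩,
    not_isBounded_strip_left L,
    ⟨_, hfreeR _ (hstrip _) hltR,
      (connectedComponentIn_freeRegion_right hRc hneR hfreeR (hstrip _) hltR).symm⟩,
    not_isBounded_strip_right R, ?_⟩
  · intro heq
    have hmem : (L 0 - 1, (0 : ℝ)) ∈ strip ∩ {p | R p.2 < p.1} := heq.le ⟨hstrip _, hltL⟩
    have hlt : R 0 < L 0 - 1 := hmem.2
    linarith
  · rintro _ ⟨p, -, rfl⟩ hub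
    by_contra! hne
    refine hub ((isBounded_strip_between hLc hRc).subset fun q hq => ?_)
    have hqs : q ∈ strip := (connectedComponentIn_subset _ _ hq).1
    refine ⟨hqs, not_lt.1 fun h => hne.1 ?_, not_lt.1 fun h => hne.2 ?_⟩
    · rw [connectedComponentIn_eq hq,
        connectedComponentIn_freeRegion_left hLc hneL hfreeL hqs h]
    · rw [connectedComponentIn_eq hq,
        connectedComponentIn_freeRegion_right hRc hneR hfreeR hqs h]
end
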